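/- arXiv:1007.3692 — 3 statements merged into one kernel-verified Lean document; each statement's English description precedes it below -/
import Mathlib

section
/- Let A ⊆ ℕ be 4-random. Then A^b is not bounded Turing reducible to A ⊕ ∅′. -/
open Classical

/-- Characteristic function of a set of naturals (values in `{0,1}`). -/
noncomputable def chi (A : Set ℕ) (n : ℕ) : ℕ := if n ∈ A then 1 else 0

/-- An acceptable enumeration `φ_e` of the partial computable functions,
via Mathlib's codes for partial recursive functions. -/
def phi (e : ℕ) : ℕ →. ℕ := (Denumerable.ofNat Nat.Partrec.Code e).eval

/-- The initial segment of (the characteristic function of) `A` of length `n`,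
as a list of naturals. -/
noncomputable def initSeg (A : Set ℕ) (n : ℕ) : List ℕ := (List.range n).map (chi A)

/-- An effective enumeration `Φ_e` of the Turing functionals: the `e`-th functional
with oracle `A` on input `x` converges iff the `e`-th partial computable function halts
on `(σ, x)` for some initial segment `σ` of `A`; its value is obtained from the least
such initial segment. -/
noncomputable def Phi (e : ℕ) (A : Set ℕ) (x : ℕ) : Part ℕ :=
  ⟨∃ n, (phi e (Nat.pair (Encodable.encode (initSeg A n)) x)).Dom,
   fun h => (phi e (Nat.pair (Encodable.encode (initSeg A (Nat.find h))) x)).get (Nat.find_spec h)⟩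

/-- `A↾n = {m ∈ A : m ≤ n}`. -/
def restrictTo (A : Set ℕ) (n : ℕ) : Set ℕ := {m | m ∈ A ∧ m ≤ n}

/-- The bounded jump `A^b = {x : ∃ i ≤ x, φ_i(x)↓ ∧ Φ_x^{A↾φ_i(x)}(x)↓}`. -/
def bJump (A : Set ℕ) : Set ℕ :=
  {x | ∃ i ≤ x, ∃ h : (phi i x).Dom, (Phi x (restrictTo A ((phi i x).get h)) x).Dom}

/-- `A^{b₀} = {⟨e,i,j⟩ : φ_i(j)↓ ∧ Φ_e^{A↾φ_i(j)}(j)↓}`, coding triples with `Nat.pair`. -/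
def b0Jump (A : Set ℕ) : Set ℕ :=
  {n | ∃ e i j, n = Nat.pair e (Nat.pair i j) ∧
        ∃ h : (phi i j).Dom, (Phi e (restrictTo A ((phi i j).get h)) j).Dom}

/-- The simple jump `A^i = {x : Φ_x^{A↾x}(x)↓}`. -/
def iJump (A : Set ℕ) : Set ℕ := {x | (Phi x (restrictTo A x) x).Dom}

/-- `∅^{nb}`, the `n`-th iterate of the bounded jump of the empty set. -/
def bIter : ℕ → Set ℕ
  | 0 => (∅ : Set ℕ)
  | n + 1 => bJump (bIter n)

/-- The halting set `∅′ = {x : φ_x(x)↓}`. -/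
def K : Set ℕ := {x | (phi x x).Dom}

/-- The effective join `A ⊕ B = {2n : n ∈ A} ∪ {2n+1 : n ∈ B}`. -/
def join (A B : Set ℕ) : Set ℕ :=
  {n | (∃ m ∈ A, n = 2 * m) ∨ (∃ m ∈ B, n = 2 * m + 1)}

/-- `X ≤₁ Y`: one-reducibility via a total computable injection. -/
def oneReducible (X Y : Set ℕ) : Prop :=
  ∃ f : ℕ → ℕ, Computable f ∧ Function.Injective f ∧ ∀ x, x ∈ X ↔ f x ∈ Y

/-- `X ≤_bT Y`: bounded Turing (weak truth-table) reducibility. There are indices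
`e, j` with `φ_j` total such that `X(x) = Φ_e^{Y↾φ_j(x)}(x)` for all `x`. -/
def bTReducible (X Y : Set ℕ) : Prop :=
  ∃ e j, ∃ h : ∀ x, (phi j x).Dom,
    ∀ x, Phi e (restrictTo Y ((phi j x).get (h x))) x = Part.some (chi X x)

/-- `X ≤_T Y`: Turing reducibility. -/
def TReducible (X Y : Set ℕ) : Prop :=
  ∃ e, ∀ x, Phi e Y x = Part.some (chi X x)

/-- `X ≤_tt Y`: truth-table reducibility, i.e. Turing reducibility via a functional
that is total on all oracles. -/
def ttReducible (X Y : Set ℕ) : Prop :=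
  ∃ e, (∀ B : Set ℕ, ∀ x, (Phi e B x).Dom) ∧ ∀ x, Phi e Y x = Part.some (chi X x)

/-- `A` is `ω^k`-c.e.: ordinals below `ω^k` are coded by their lists of Cantor normal
form coefficients (length-`k` lists of naturals, most significant first), ordered
lexicographically.  There is a partial computable `ψ : ℕ × ω^k → {0,1}` such that for
every `n` some `ψ(n,β)` converges, and `A(n) = ψ(n,γ)` for the least converging `γ`. -/
def OmegaCE (k : ℕ) (A : Set ℕ) : Prop :=
  ∃ ψ : ℕ →. ℕ, Partrec ψ ∧ (∀ m y, y ∈ ψ m → y ≤ 1) ∧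
    ∀ n : ℕ, ∃ l : List ℕ, l.length = k ∧
      (∀ l' : List ℕ, l'.length = k → List.Lex (· < ·) l' l →
        ¬ (ψ (Nat.pair n (Encodable.encode l'))).Dom) ∧
      chi A n ∈ ψ (Nat.pair n (Encodable.encode l))

/-- The (lightface) `Σ_n` sets of naturals. -/
def SigmaN : ℕ → Set ℕ → Prop
  | 0 => fun S => ComputablePred (· ∈ S)
  | n + 1 => fun S => ∃ R : Set ℕ, SigmaN n R ∧ S = {x | ∃ y, Nat.pair x y ∉ R}

/-- The initial segment of `A` of length `n`, as a finite binary string. -/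
noncomputable def initSegB (A : Set ℕ) (n : ℕ) : List Bool :=
  (List.range n).map fun i => decide (i ∈ A)

/-- `A` is `n`-generic: for every `Σ_n` set `S` of (codes of) finite binary strings,
either some initial segment of `A` is in `S`, or some initial segment of `A` has no
extension in `S`. -/
def NGeneric (n : ℕ) (A : Set ℕ) : Prop :=
  ∀ S : Set ℕ, SigmaN n S →
    (∃ l, Encodable.encode (initSegB A l) ∈ S) ∨
    (∃ l, ∀ τ : List Bool, initSegB A l <+: τ → Encodable.encode τ ∉ S)

/-- The open subset of Cantor space generated by the set of strings `U` has measure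
`≤ 2^{-i}`: for every `n`, at most `2^n/2^i` strings of length `n` extend a string
of `U`. -/
def stringMeasureLe (U : Set (List Bool)) (i : ℕ) : Prop :=
  ∀ n : ℕ, ({σ : List Bool | σ.length = n ∧ ∃ τ ∈ U, τ <+: σ}.ncard) * 2 ^ i ≤ 2 ^ n

/-- `A` is `n`-random: for every uniformly `Σ_n` family `⟨U_i⟩` of sets of (codes of)
finite binary strings with `μ(U_i) ≤ 2^{-i}`, there is an `l` such that no initial
segment of `A` lies in `U_l`. -/
def NRandom (n : ℕ) (A : Set ℕ) : Prop :=
  ∀ U : Set ℕ, SigmaN n U →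
    (∀ i, stringMeasureLe {σ : List Bool | Nat.pair i (Encodable.encode σ) ∈ U} i) →
    ∃ l, ∀ m, Nat.pair l (Encodable.encode (initSegB A m)) ∉ U

/-- The code `c` codes a tt-condition (a finite sequence of positions together with a
truth table) satisfied by `A`. -/
def ttSatisfied (A : Set ℕ) (c : ℕ) : Prop :=
  ∃ p : List ℕ × List Bool, Encodable.decode c = some p ∧
    p.2.length = 2 ^ p.1.length ∧
    p.2.getD (p.1.foldr (fun x acc => 2 * acc + chi A x) 0) false = true

/-- `A^{tt}`: the set of codes of tt-conditions satisfied by `A`. -/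
def ttSet (A : Set ℕ) : Set ℕ := {c | ttSatisfied A c}

/-- Gerla's truth-table jump `A_tt = {x : φ_x(x)↓ ∧ φ_x(x) ∈ A^{tt}}`. -/
def gerlaJump (A : Set ℕ) : Set ℕ :=
  {x | ∃ h : (phi x x).Dom, (phi x x).get h ∈ ttSet A}

open Nat.Partrec (Code)

/-! ### Computable enumerations of a `Σ₄` set of `lim inf` type -/

/-- A set of the form `{x | ∃ a, ∀ b, C x (a + b)}` with `C` computable is `Σ₄`. -/
theorem sigmaN_four_of_eventually {C : ℕ → ℕ → Bool} (hC : Computable₂ C) :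
    SigmaN 4 {x | ∃ a, ∀ b, C x (a + b) = true} := by
  refine ⟨{x | ∃ b, C x.unpair.1 (x.unpair.2 + b) = false},
    ⟨{x | C x.unpair.1.unpair.1 (x.unpair.1.unpair.2 + x.unpair.2) = true},
      ⟨{x | ∃ _ : ℕ, C x.unpair.1.unpair.1.unpair.1
          (x.unpair.1.unpair.1.unpair.2 + x.unpair.1.unpair.2) = false},
        ⟨{x | C x.unpair.1.unpair.1.unpair.1.unpair.1
          (x.unpair.1.unpair.1.unpair.1.unpair.2 + x.unpair.1.unpair.1.unpair.2) = true},
          ⟨inferInstance, ?_⟩, ?_⟩, ?_⟩, ?_⟩, ?_⟩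
  · have hl : Computable fun n : ℕ => n.unpair.1 :=
      (Primrec.fst.comp Primrec.unpair).to_comp
    have hr : Computable fun n : ℕ => n.unpair.2 :=
      (Primrec.snd.comp Primrec.unpair).to_comp
    have h3 := hl.comp (hl.comp hl)
    exact (hC.comp (hl.comp h3)
      (Primrec.nat_add.to_comp.comp (hr.comp h3) (hr.comp (hl.comp hl)))).of_eq
        fun n => by simp
  all_goals ext x; simp

/-! ### Counting strings on which a prediction strategy succeeds -/

/-- The strings of length `n` on which the strategy `P`, predicting the bit at position `p t` from
the bits before it, is right for every `t < l`. -/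
def predictedStrings (p : ℕ → ℕ) (P : ℕ → List Bool → Bool) (l n : ℕ) : Set (List Bool) :=
  {σ | σ.length = n ∧ ∀ t < l, σ[p t]? = some (P t (σ.take (p t)))}

theorem finite_lists_length_and (n : ℕ) (Q : List Bool → Prop) :
    {σ : List Bool | σ.length = n ∧ Q σ}.Finite :=
  (List.finite_length_eq Bool n).subset fun _ h => h.1

theorem take_modify_of_le {α : Type*} (g : α → α) {d i : ℕ} (h : d ≤ i) (σ : List α) :
    (σ.modify i g).take d = σ.take d := by
  apply List.ext_getElem?
  intro k
  simp only [List.getElem?_take]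
  split
  · exact List.getElem?_modify_ne g _ (by omega)
  · rfl

theorem ncard_predictedStrings_succ_mul_two {p : ℕ → ℕ} (hp : StrictMono p)
    (P : ℕ → List Bool → Bool) (l n : ℕ) :
    (predictedStrings p P (l + 1) n).ncard * 2 ≤ (predictedStrings p P l n).ncard := by
  set S := predictedStrings p P (l + 1) n
  set T := predictedStrings p P l n
  have hT : T.Finite := finite_lists_length_and n _
  have hS : S.Finite := finite_lists_length_and n _
  let flip : List Bool → List Bool := fun σ => σ.modify (p l) not
  have flip_flip : ∀ σ, flip (flip σ) = σ := fun σ => by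
    apply List.ext_getElem?
    intro i
    simp only [flip, List.getElem?_modify]
    split <;> cases σ[i]? <;> simp
  have hinj : Function.Injective flip := Function.LeftInverse.injective flip_flip
  have hdisj : Disjoint S (flip '' S) := by
    rw [Set.disjoint_left]
    rintro _ hσ ⟨σ, hσ', rfl⟩
    have h1 := hσ.2 l (Nat.lt_succ_self l)
    have h2 := hσ'.2 l (Nat.lt_succ_self l)
    have h3 : (flip σ).take (p l) = σ.take (p l) := take_modify_of_le _ le_rfl σ
    rw [h3, List.getElem?_modify, h2] at h1
    simp at h1
  have hsub : S ∪ flip '' S ⊆ T := by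
    rintro σ (hσ | ⟨σ, hσ, rfl⟩)
    · exact ⟨hσ.1, fun t ht => hσ.2 t (ht.trans (Nat.lt_succ_self l))⟩
    · refine ⟨by simpa [flip] using hσ.1, fun t ht => ?_⟩
      have hlt : p t < p l := hp ht
      have h3 : (flip σ).take (p t) = σ.take (p t) := take_modify_of_le _ hlt.le σ
      rw [h3, ← hσ.2 t (ht.trans (Nat.lt_succ_self l))]
      exact List.getElem?_modify_ne _ _ hlt.ne'
  calc S.ncard * 2 = S.ncard + (flip '' S).ncard := by
        rw [Set.ncard_image_of_injective S hinj]; ring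
    _ = (S ∪ flip '' S).ncard := (Set.ncard_union_eq hdisj hS (hS.image _)).symm
    _ ≤ T.ncard := Set.ncard_le_ncard hsub hT

theorem ncard_predictedStrings_mul_two_pow {p : ℕ → ℕ} (hp : StrictMono p)
    (P : ℕ → List Bool → Bool) (l n : ℕ) :
    (predictedStrings p P l n).ncard * 2 ^ l ≤ 2 ^ n := by
  induction l with
  | zero =>
    have h : predictedStrings p P 0 n = {σ | σ.length = n} := by simp [predictedStrings]
    have hcard : Nat.card (List.Vector Bool n) = 2 ^ n := by simp
    rw [h, pow_zero, mul_one, ← hcard, ← Nat.card_coe_set_eq]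
    exact le_rfl
  | succ l ih =>
    calc _ = (predictedStrings p P (l + 1) n).ncard * 2 * 2 ^ l := by ring
      _ ≤ (predictedStrings p P l n).ncard * 2 ^ l :=
        Nat.mul_le_mul_right _ (ncard_predictedStrings_succ_mul_two hp P l n)
      _ ≤ 2 ^ n := ih

theorem prediction_right_of_extends {p : ℕ → ℕ} {P : ℕ → List Bool → Bool} {l : ℕ}
    {τ σ : List Bool} (hτ : ∀ t < l, τ[p t]? = some (P t (τ.take (p t)))) (h : τ <+: σ) :
    ∀ t < l, σ[p t]? = some (P t (σ.take (p t))) := by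
  obtain ⟨ρ, rfl⟩ := h
  intro t ht
  have hlt : p t < τ.length := (List.getElem?_eq_some_iff.1 (hτ t ht)).1
  rw [List.getElem?_append_left hlt, List.take_append_of_le_length hlt.le, hτ t ht]

/-- The open set generated by the strings on which infinitely often revised strategies `P s` are
right for every `t < l` and almost every `s` has measure at most `2⁻ˡ`. -/
theorem stringMeasureLe_eventually_predicted {p : ℕ → ℕ} (hp : StrictMono p)
    (P : ℕ → ℕ → List Bool → Bool) (l : ℕ) :
    stringMeasureLe {σ | ∃ a, ∀ s ≥ a, ∀ t < l, σ[p t]? = some (P s t (σ.take (p t)))} l := by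
  intro n
  set E := {σ : List Bool | σ.length = n ∧ ∃ τ ∈ {σ : List Bool | ∃ a, ∀ s ≥ a, ∀ t < l,
    σ[p t]? = some (P s t (σ.take (p t)))}, τ <+: σ}
  have hE : E.Finite := finite_lists_length_and n _
  have hev : ∀ σ ∈ E, ∀ᶠ s in Filter.atTop, σ ∈ predictedStrings p (P s) l n := by
    rintro σ ⟨hlen, τ, ⟨a, ha⟩, hτσ⟩
    filter_upwards [Filter.eventually_ge_atTop a] with s hs
    exact ⟨hlen, prediction_right_of_extends (ha s hs) hτσ⟩
  obtain ⟨s, hs⟩ := ((Filter.eventually_all_finite hE).2 hev).exists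
  have hfin : (predictedStrings p (P s) l n).Finite := finite_lists_length_and n _
  exact (Nat.mul_le_mul_right _ (Set.ncard_le_ncard hs hfin)).trans
    (ncard_predictedStrings_mul_two_pow hp (P s) l n)

/-! ### Approximating a bounded computation from `A ⊕ K` -/

/-- `K`, enumerated up to stage `s`. -/
def haltsBy (s m : ℕ) : Bool := (Code.evaln s (Denumerable.ofNat Code m) m).isSome

/-- The first `n` values of `(τ ⊕ Kₛ)↾b`, where `Kₛ` is `K` enumerated up to stage `s`. -/
def approxOracle (τ : List Bool) (b s n : ℕ) : List ℕ :=
  (List.range n).map fun m =>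
    bif decide (m ≤ b) &&
      (bif m.bodd then haltsBy s m.div2 else (τ[m.div2]?).getD false) then 1 else 0

/-- The stage `s` approximation of the value at `x` of the functional with code `c` relative to
`(τ ⊕ K)↾b`. -/
def approxPhi (c : Code) (τ : List Bool) (b s x : ℕ) : Option ℕ :=
  ((List.range s).filterMap fun n =>
    Code.evaln s c (Nat.pair (Encodable.encode (approxOracle τ b s n)) x)).head?

theorem primrec_haltsBy : Primrec₂ haltsBy :=
  Primrec.option_isSome.comp (Code.primrec_evaln.comp
    ((Primrec.fst.pair ((Primrec.ofNat Code).comp Primrec.snd)).pair Primrec.snd))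

theorem primrec_approxOracle :
    Primrec fun a : (List Bool × ℕ) × (ℕ × ℕ) => approxOracle a.1.1 a.1.2 a.2.1 a.2.2 := by
  have hτ : Primrec fun q : ((List Bool × ℕ) × (ℕ × ℕ)) × ℕ => q.1.1.1 :=
    Primrec.fst.comp (Primrec.fst.comp Primrec.fst)
  have hb : Primrec fun q : ((List Bool × ℕ) × (ℕ × ℕ)) × ℕ => q.1.1.2 :=
    Primrec.snd.comp (Primrec.fst.comp Primrec.fst)
  have hs : Primrec fun q : ((List Bool × ℕ) × (ℕ × ℕ)) × ℕ => q.1.2.1 :=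
    Primrec.fst.comp (Primrec.snd.comp Primrec.fst)
  have hm : Primrec fun q : ((List Bool × ℕ) × (ℕ × ℕ)) × ℕ => q.2 := Primrec.snd
  have hd := Primrec.nat_div2.comp hm
  refine Primrec.list_map (Primrec.list_range.comp (Primrec.snd.comp Primrec.snd)) ?_
  refine Primrec.cond (Primrec.and.comp (Primrec.nat_le.decide.comp hm hb) ?_)
    (Primrec.const 1) (Primrec.const 0)
  exact Primrec.cond (Primrec.nat_bodd.comp hm) (primrec_haltsBy.comp hs hd)
    (Primrec.option_getD.comp (Primrec.list_getElem?.comp hτ hd) (Primrec.const false))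

theorem primrec_approxPhi (c : Code) :
    Primrec fun a : (List Bool × ℕ) × (ℕ × ℕ) => approxPhi c a.1.1 a.1.2 a.2.1 a.2.2 := by
  have hs : Primrec fun q : ((List Bool × ℕ) × (ℕ × ℕ)) × ℕ => q.1.2.1 :=
    Primrec.fst.comp (Primrec.snd.comp Primrec.fst)
  have hx : Primrec fun q : ((List Bool × ℕ) × (ℕ × ℕ)) × ℕ => q.1.2.2 :=
    Primrec.snd.comp (Primrec.snd.comp Primrec.fst)
  refine Primrec.list_head?.comp (Primrec.listFilterMap
    (Primrec.list_range.comp (Primrec.fst.comp Primrec.snd)) ?_)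
  exact Code.primrec_evaln.comp ((hs.pair (Primrec.const c)).pair
    (Primrec₂.natPair.comp (Primrec.encode.comp (primrec_approxOracle.comp
      ((Primrec.fst.comp Primrec.fst).pair (hs.pair Primrec.snd)))) hx))

theorem computable_approxPhi {α : Type*} [Primcodable α] (c : Code) {τ : α → List Bool}
    {b s x : α → ℕ} (hτ : Computable τ) (hb : Computable b) (hs : Computable s)
    (hx : Computable x) : Computable fun a => approxPhi c (τ a) (b a) (s a) (x a) :=
  Computable.comp (g := fun a : α => ((τ a, b a), (s a, x a))) (primrec_approxPhi c).to_comp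
    ((hτ.pair hb).pair (hs.pair hx))

theorem haltsBy_mono {s s' m : ℕ} (h : s ≤ s') (hm : haltsBy s m = true) :
    haltsBy s' m = true := by
  obtain ⟨v, hv⟩ := Option.isSome_iff_exists.1 hm
  exact Option.isSome_iff_exists.2 ⟨v, Code.evaln_mono h hv⟩

theorem mem_K_iff_exists_haltsBy {m : ℕ} : m ∈ K ↔ ∃ s, haltsBy s m = true := by
  simp only [K, Set.mem_ofPred_eq, Part.dom_iff_mem, phi, Code.evaln_complete, haltsBy,
    Option.isSome_iff_exists]
  exact exists_comm

theorem eventually_haltsBy (m : ℕ) :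
    ∀ᶠ s in Filter.atTop, haltsBy s m = decide (m ∈ K) := by
  by_cases hm : m ∈ K
  · obtain ⟨s, hs⟩ := mem_K_iff_exists_haltsBy.1 hm
    filter_upwards [Filter.eventually_ge_atTop s] with s' hs'
    simp [hm, haltsBy_mono hs' hs]
  · refine Filter.Eventually.of_forall fun s => ?_
    simpa [hm] using fun h => hm (mem_K_iff_exists_haltsBy.2 ⟨s, h⟩)

theorem mem_join_iff {A B : Set ℕ} {n : ℕ} :
    n ∈ join A B ↔ if n.bodd then n.div2 ∈ B else n.div2 ∈ A := by
  have hn := Nat.bodd_add_div2 n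
  cases hb : n.bodd
  · rw [hb] at hn
    simp only [Bool.toNat_false] at hn
    simp only [join, Set.mem_ofPred_eq, Bool.false_eq_true, if_false]
    constructor
    · rintro (⟨m, hm, h⟩ | ⟨m, hm, h⟩)
      · rwa [show n.div2 = m by omega]
      · omega
    · exact fun h => Or.inl ⟨_, h, by omega⟩
  · rw [hb] at hn
    simp only [Bool.toNat_true] at hn
    simp only [join, Set.mem_ofPred_eq, if_true]
    constructor
    · rintro (⟨m, hm, h⟩ | ⟨m, hm, h⟩)
      · omega
      · rwa [show n.div2 = m by omega]
    · exact fun h => Or.inr ⟨_, h, by omega⟩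

theorem getElem?_initSegB {A : Set ℕ} {d m : ℕ} (h : m < d) :
    (initSegB A d)[m]? = some (decide (m ∈ A)) := by
  simp [initSegB, h]

theorem eventually_approxOracle (A : Set ℕ) {b d : ℕ} (hbd : b < d) :
    ∀ᶠ s in Filter.atTop, ∀ n,
      approxOracle (initSegB A d) b s n = initSeg (restrictTo (join A K) b) n := by
  have hK : ∀ᶠ s in Filter.atTop, ∀ m ∈ Set.Iic b, haltsBy s m = decide (m ∈ K) :=
    (Filter.eventually_all_finite (Set.finite_Iic b)).2 fun m _ => eventually_haltsBy m
  filter_upwards [hK] with s hs n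
  refine List.map_congr_left fun m _ => ?_
  have hle : m.div2 ≤ m := by rw [Nat.div2_val]; exact Nat.div_le_self m 2
  unfold chi
  by_cases hm : m ≤ b
  · have hmem : m ∈ restrictTo (join A K) b ↔ m ∈ join A K := by simp [restrictTo, hm]
    rw [if_congr (hmem.trans mem_join_iff) rfl rfl, getElem?_initSegB (by omega),
      hs _ (show m.div2 ≤ b by omega)]
    cases m.bodd <;> simp [hm, Bool.cond_eq_ite]
  · simp [hm, restrictTo]

theorem eventually_evaln {c : Code} {n v : ℕ} (h : v ∈ c.eval n) :
    ∀ᶠ s in Filter.atTop, Code.evaln s c n = some v := by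
  obtain ⟨k, hk⟩ := Code.evaln_complete.1 h
  filter_upwards [Filter.eventually_ge_atTop k] with s hs
  exact Code.evaln_mono hs hk

theorem eventually_approxPhi {A : Set ℕ} {e b d x v : ℕ} (hbd : b < d)
    (h : Phi e (restrictTo (join A K) b) x = Part.some v) :
    ∀ᶠ s in Filter.atTop,
      approxPhi (Denumerable.ofNat Code e) (initSegB A d) b s x = some v := by
  obtain ⟨hdom, hget⟩ := Part.eq_some_iff.1 h
  set Y := restrictTo (join A K) b
  change ∃ n, (phi e (Nat.pair (Encodable.encode (initSeg Y n)) x)).Dom at hdom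
  have hv : v ∈ phi e (Nat.pair (Encodable.encode (initSeg Y (Nat.find hdom))) x) :=
    ⟨Nat.find_spec hdom, hget⟩
  filter_upwards [eventually_approxOracle A hbd, eventually_evaln hv,
    Filter.eventually_gt_atTop (Nat.find hdom)] with s hs hval hlt
  rw [approxPhi, List.head?_filterMap, List.findSome?_eq_some_iff]
  obtain ⟨k, rfl⟩ := Nat.exists_eq_add_of_lt hlt
  refine ⟨List.range (Nat.find hdom), Nat.find hdom, (List.range k).map (Nat.find hdom + 1 + ·),
    ?_, ?_, ?_⟩
  · rw [add_right_comm, List.range_add, List.range_succ]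
    simp
  · rw [hs]; exact hval
  · intro n hn
    rw [hs, Option.eq_none_iff_forall_ne_some]
    intro u hu
    exact Nat.find_min hdom (List.mem_range.1 hn)
      (Part.dom_iff_mem.2 ⟨u, Code.evaln_sound hu⟩)

/-! ### Indices whose bounded jump reads a late bit of the oracle -/

/-- Pairwise distinct codes for the function computed by `c`. -/
def padCode (c : Code) : ℕ → Code
  | 0 => c
  | k + 1 => (padCode c k).comp Code.id

theorem eval_padCode (c : Code) (k : ℕ) : (padCode c k).eval = c.eval := by
  induction k with
  | zero => rfl
  | succ k ih =>
    funext n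
    change (Code.id.eval n >>= (padCode c k).eval) = _
    rw [Code.eval_id, ih]
    exact Part.bind_some _ _

theorem strictMono_encode_padCode (c : Code) :
    StrictMono fun k => Encodable.encode (padCode c k) :=
  strictMono_nat_of_lt_succ fun _ => (Code.encode_lt_comp _ _).1

theorem primrec_padCode (c : Code) : Primrec (padCode c) := by
  refine (Primrec.nat_rec₁ (f := fun _ d => Code.comp d Code.id) c
    (Code.primrec₂_comp.comp Primrec.snd (Primrec.const Code.id))).of_eq fun k => ?_
  induction k with
  | zero => rfl
  | succ k ih => simp only [padCode, ← ih]

/-- For computable `h` there is a computable increasing sequence of indices `z t` such that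
`z t ∈ A^b` exactly when `h (z t) ∈ A`. -/
theorem exists_indices_bJump_iff {h : ℕ → ℕ} (hh : Computable h) :
    ∃ z : ℕ → ℕ, Computable z ∧ StrictMono z ∧
      ∀ (A : Set ℕ) (t : ℕ), z t ∈ bJump A ↔ h (z t) ∈ A := by
  let f : ℕ → Option ℕ := fun w =>
    ((Denumerable.ofNat (List ℕ) w.unpair.1)[h w.unpair.2]?).bind
      fun v => bif v == 1 then some 0 else none
  have hf : Computable f := by
    have hl : Computable fun w : ℕ => Denumerable.ofNat (List ℕ) w.unpair.1 :=
      ((Primrec.ofNat (List ℕ)).comp (Primrec.fst.comp Primrec.unpair)).to_comp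
    have hr : Computable fun w : ℕ => h w.unpair.2 :=
      hh.comp (Primrec.snd.comp Primrec.unpair).to_comp
    refine Computable.option_bind (Computable.list_getElem?.comp hl hr) ?_
    exact (Primrec.cond (Primrec.beq.comp Primrec.snd (Primrec.const 1))
      (Primrec.const (some 0)) (Primrec.const none)).to_comp
  obtain ⟨c, hc⟩ := Code.exists_code.1 (Partrec.nat_iff.1 hf.ofOption)
  obtain ⟨ch, hch⟩ := Code.exists_code.1 (Partrec.nat_iff.1 hh)
  set i := Encodable.encode ch
  have hphi_i : ∀ x, phi i x = Part.some (h x) := fun x => by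
    rw [phi, Denumerable.ofNat_encode, hch]; rfl
  have hpadmono := strictMono_encode_padCode c
  have hphi : ∀ k L x, (phi (Encodable.encode (padCode c k))
      (Nat.pair (Encodable.encode (L : List ℕ)) x)).Dom ↔ L[h x]? = some 1 := fun k L x => by
    rw [phi, Denumerable.ofNat_encode, eval_padCode, hc]
    cases hL : L[h x]? with
    | none => simp [f, hL]
    | some v =>
      by_cases hv : v = 1 <;> simp [f, hL, hv, Bool.cond_eq_ite]
  refine ⟨fun t => Encodable.encode (padCode c (i + t)), ?_, fun s t hst => hpadmono (by omega),
    fun A t => ?_⟩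
  · exact (Primrec.encode.comp ((primrec_padCode c).comp
      (Primrec.nat_add.comp (Primrec.const i) Primrec.id))).to_comp
  · set x := Encodable.encode (padCode c (i + t))
    have hinit : ∀ (B : Set ℕ) n, (initSeg B n)[h x]? = some 1 ↔ h x < n ∧ h x ∈ B := by
      intro B n
      simp only [initSeg, List.getElem?_map, Option.map_eq_some_iff, List.getElem?_eq_some_iff]
      simp [chi]
    constructor
    · rintro ⟨j, -, hj, n, hn⟩
      exact ((hinit _ n).1 ((hphi _ _ _).1 hn)).2.1
    · intro hA
      have hix : i ≤ x := (Nat.le_add_right i t).trans (hpadmono.le_apply)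
      refine ⟨i, hix, by simp [hphi_i], h x + 1, (hphi _ _ _).2 ((hinit _ _).2 ⟨by omega, hA, ?_⟩)⟩
      simp only [hphi_i, Part.get_some]
      exact le_rfl

/-- Every computable function is strictly dominated by a computable increasing one. -/
theorem exists_computable_strictMono_gt {g : ℕ → ℕ} (hg : Computable g) :
    ∃ h : ℕ → ℕ, Computable h ∧ StrictMono h ∧ ∀ x, g x < h x := by
  let h : ℕ → ℕ := fun n => Nat.rec (g 0 + 1) (fun n r => r + (g (n + 1) + 1)) n
  refine ⟨h, ?_, strictMono_nat_of_lt_succ fun n => ?_, fun x => ?_⟩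
  · refine Computable.nat_rec (f := fun n => n) (h := fun _ q => q.2 + (g (q.1 + 1) + 1))
      Computable.id (Computable.const (g 0 + 1)) ?_
    have hn : Computable fun q : ℕ × (ℕ × ℕ) => q.2.1 := Computable.fst.comp Computable.snd
    have hr : Computable fun q : ℕ × (ℕ × ℕ) => q.2.2 := Computable.snd.comp Computable.snd
    exact Primrec.nat_add.to_comp.comp hr
      (Computable.succ.comp (hg.comp (Computable.succ.comp hn)))
  · change h n < h n + (g (n + 1) + 1)
    omega
  · cases x with
    | zero => exact Nat.lt_succ_self _
    | succ n =>
      change g (n + 1) < h n + (g (n + 1) + 1)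
      omega

/-- Conjunction of `f a t` over `t < m a`. -/
theorem computable_forall_lt {α : Type*} [Primcodable α] {m : α → ℕ} {f : α → ℕ → Bool}
    (hm : Computable m) (hf : Computable₂ f) :
    Computable fun a => decide (∀ t < m a, f a t = true) := by
  have hrec : Computable fun a => Nat.rec (motive := fun _ => Bool) true
      (fun t acc => acc && f a t) (m a) :=
    Computable.nat_rec (h := fun a q => q.2 && f a q.1) hm (Computable.const true) (Primrec.and.to_comp.comp
      (Computable.snd.comp Computable.snd)
      (hf.comp Computable.fst (Computable.fst.comp Computable.snd)))
  refine hrec.of_eq fun a => ?_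
  induction m a with
  | zero => simp
  | succ k ih =>
    simp only [ih, Nat.forall_lt_succ_right]
    simp

/-- If `A` is 4-random then `A^b` is not bounded Turing reducible to `A ⊕ ∅′`. -/
theorem bJump_not_bT_join_of_4random (A : Set ℕ) (h : NRandom 4 A) :
    ¬ bTReducible (bJump A) (join A K) := by
  rintro ⟨e, j, htot, hred⟩
  set g : ℕ → ℕ := fun x => (phi j x).get (htot x)
  have hg : Computable g := by
    have hpart : Partrec (phi j) :=
      Code.eval_part.comp (Computable.const (Denumerable.ofNat Code j)) Computable.id
    exact hpart.of_eq fun x => (Part.some_get (htot x)).symm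
  obtain ⟨b, hb, hbmono, hgb⟩ := exists_computable_strictMono_gt hg
  obtain ⟨z, hz, hzmono, hzA⟩ := exists_indices_bJump_iff hb
  set p : ℕ → ℕ := fun t => b (z t)
  have hp : StrictMono p := hbmono.comp hzmono
  let P : ℕ → ℕ → List Bool → Bool := fun s t τ =>
    decide (approxPhi (Denumerable.ofNat Code e) τ (g (z t)) s (z t) = some 1)
  let right : List Bool → ℕ → ℕ → Bool := fun σ s t =>
    decide (σ[p t]? = some (P s t (σ.take (p t))))
  let C : ℕ → ℕ → Bool := fun x s => decide (∀ t < x.unpair.1,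
    right ((Encodable.decode (α := List Bool) x.unpair.2).getD []) s t = true)
  have hC : Computable₂ C := by
    have hσ : Computable fun q : (ℕ × ℕ) × ℕ =>
        (Encodable.decode (α := List Bool) q.1.1.unpair.2).getD [] :=
      Primrec.option_getD.to_comp.comp (Computable.decode.comp
        ((Primrec.snd.comp Primrec.unpair).to_comp.comp (Computable.fst.comp Computable.fst)))
        (Computable.const [])
    have hs : Computable fun q : (ℕ × ℕ) × ℕ => q.1.2 := Computable.snd.comp Computable.fst
    have hzt : Computable fun q : (ℕ × ℕ) × ℕ => z q.2 := hz.comp Computable.snd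
    have hpt : Computable fun q : (ℕ × ℕ) × ℕ => p q.2 := hb.comp hzt
    refine computable_forall_lt
      ((Primrec.fst.comp Primrec.unpair).to_comp.comp Computable.fst) ?_
    have htake : Computable fun q : (ℕ × ℕ) × ℕ =>
        ((Encodable.decode (α := List Bool) q.1.1.unpair.2).getD []).take (p q.2) :=
      Primrec.list_take.to_comp.comp hpt hσ
    have hphi : Computable fun q : (ℕ × ℕ) × ℕ => approxPhi (Denumerable.ofNat Code e)
        (((Encodable.decode (α := List Bool) q.1.1.unpair.2).getD []).take (p q.2))
        (g (z q.2)) q.1.2 (z q.2) :=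
      computable_approxPhi _ htake (hg.comp hzt) hs hzt
    have hP : Computable fun q : (ℕ × ℕ) × ℕ => P q.1.2 q.2
        (((Encodable.decode (α := List Bool) q.1.1.unpair.2).getD []).take (p q.2)) :=
      (Primrec.eq (α := Option ℕ)).decide.to_comp.comp hphi (Computable.const (some 1))
    exact (Primrec.eq (α := Option Bool)).decide.to_comp.comp
      (Computable.list_getElem?.comp hσ hpt) (Computable.option_some.comp hP)
  have hCσ : ∀ l σ s, C (Nat.pair l (Encodable.encode σ)) s = true ↔
      ∀ t < l, right σ s t = true := fun l σ s => by
    simp only [C, Nat.unpair_pair, Encodable.encodek, Option.getD_some, decide_eq_true_eq]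
  have hmeasure : ∀ l, stringMeasureLe {σ | Nat.pair l (Encodable.encode σ) ∈
      {x | ∃ a, ∀ k, C x (a + k) = true}} l := fun l => by
    have hset : {σ : List Bool | Nat.pair l (Encodable.encode σ) ∈ {x | ∃ a, ∀ k, C x (a + k) = true}} =
        {σ | ∃ a, ∀ s ≥ a, ∀ t < l, σ[p t]? = some (P s t (σ.take (p t)))} := by
      ext σ
      simp only [Set.mem_ofPred_eq, hCσ, right, decide_eq_true_eq]
      exact exists_congr fun a => ⟨fun H s hs => by
        obtain ⟨k, rfl⟩ := Nat.exists_eq_add_of_le hs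
        exact H k, fun H k => H _ (Nat.le_add_right a k)⟩
    rw [hset]
    exact stringMeasureLe_eventually_predicted hp P l
  obtain ⟨l, hl⟩ := h _ (sigmaN_four_of_eventually hC) hmeasure
  have hright : ∀ᶠ s in Filter.atTop, ∀ t ∈ Set.Iio l,
      right (initSegB A (p l)) s t = true := by
    refine (Filter.eventually_all_finite (Set.finite_Iio l)).2 fun t ht => ?_
    have hlt : p t < p l := hp ht
    filter_upwards [eventually_approxPhi (hgb (z t)) (hred (z t))] with s hs
    have htake : (initSegB A (p l)).take (p t) = initSegB A (p t) := by
      simp [initSegB, ← List.map_take, List.take_range, hlt.le]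
    have hiff : b (z t) ∈ A ↔ z t ∈ bJump A := (hzA A t).symm
    simp only [right, P, htake, getElem?_initSegB hlt, decide_eq_true_eq, Option.some.injEq]
    rw [hs]
    by_cases hmem : z t ∈ bJump A
    · simp [p, chi, hiff, hmem]
    · simp [p, chi, hiff, hmem]
  obtain ⟨a, ha⟩ := Filter.eventually_atTop.1 hright
  exact hl (p l) ⟨a, fun k => (hCσ _ _ _).2 (ha (a + k) (Nat.le_add_right a k))⟩
end

section
/- Let A ⊆ ℕ be ω²-c.e. Then A ≤₁ ∅^{2b}, the second iterate of the bounded jump of the empty set. -/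
open Classical

section CodeSearch

open Nat.Partrec Encodable

variable {α β : Type*} [Primcodable α] [Primcodable β]

theorem exists_partrec_search {P : α → β → Bool} (hP : Primrec₂ P) :
    ∃ F : α →. β, Partrec F ∧ (∀ a, (F a).Dom ↔ ∃ b, P a b) ∧ ∀ a, ∀ b ∈ F a, P a b := by
  have hf : Computable₂ fun (a : α) (t : ℕ) =>
      (decode (α := β) t).bind fun b => bif P a b then some b else none := by
    refine Primrec₂.to_comp (Primrec.option_bind (Primrec.decode.comp Primrec.snd) ?_)
    exact Primrec.cond (hP.comp (Primrec.fst.comp Primrec.fst) Primrec.snd)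
      (Primrec.option_some.comp Primrec.snd) (Primrec.const none)
  refine ⟨_, Partrec.rfindOpt hf, fun a => ?_, fun a b hb => ?_⟩
  · rw [Nat.rfindOpt_dom]
    constructor
    · rintro ⟨t, b, hb⟩
      simp only [Option.mem_def, Option.bind_eq_some_iff] at hb
      obtain ⟨b', -, hb'⟩ := hb
      cases h : P a b' <;> simp [h] at hb'
      exact ⟨b', h⟩
    · rintro ⟨b, hb⟩
      exact ⟨encode b, b, by simp [hb]⟩
  · obtain ⟨t, ht⟩ := Nat.rfindOpt_spec hb
    simp only [Option.mem_def, Option.bind_eq_some_iff] at ht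
    obtain ⟨b', -, hb'⟩ := ht
    cases h : P a b' <;> simp [h] at hb'
    exact hb' ▸ h

theorem exists_code_search {P : α → β → Bool} (hP : Primrec₂ P) {g : α → β → ℕ}
    (hg : Primrec₂ g) :
    ∃ c : Code, (∀ a, (c.eval (encode a)).Dom ↔ ∃ b, P a b) ∧
      ∀ a, ∀ y ∈ c.eval (encode a), ∃ b, P a b ∧ y = g a b := by
  obtain ⟨F, hF, hdom, hmem⟩ := exists_partrec_search hP
  obtain ⟨c, hc⟩ := Code.exists_code.1 (hF.map hg.to_comp)
  have he : ∀ a, c.eval (encode a) = (F a).map (g a) := fun a => by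
    simp [hc, Part.map_id']
  refine ⟨c, fun a => ?_, fun a y hy => ?_⟩
  · rw [he]
    exact hdom a
  · rw [he, Part.mem_map_iff] at hy
    obtain ⟨b, hb, rfl⟩ := hy
    exact ⟨b, hmem a b hb, rfl⟩

theorem exists_computable_search {P : α → β → Bool} (hP : Primrec₂ P) (h : ∀ a, ∃ b, P a b) :
    ∃ f : α → β, Computable f ∧ ∀ a, P a (f a) := by
  obtain ⟨F, hF, hdom, hmem⟩ := exists_partrec_search hP
  have hd a : (F a).Dom := (hdom a).2 (h a)
  refine ⟨fun a => (F a).get (hd a), hF.of_eq fun a => ?_, fun a => hmem a _ (Part.get_mem _)⟩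
  simp

theorem exists_primrec_bound {g : α → ℕ → ℕ} (hg : Primrec₂ g) :
    ∃ G : α → ℕ → ℕ, Primrec₂ G ∧ ∀ a j k, j ≤ k → g a j ≤ G a k := by
  refine ⟨fun a k => Nat.rec (g a 0) (fun i r => r + g a (i + 1)) k, ?_, ?_⟩
  · refine Primrec.nat_rec (f := fun a => g a 0) (g := fun a p => p.2 + g a (p.1 + 1))
      (hg.comp Primrec.id (Primrec.const 0)) ?_
    exact Primrec.nat_add.comp (Primrec.snd.comp Primrec.snd)
      (hg.comp Primrec.fst (Primrec.succ.comp (Primrec.fst.comp Primrec.snd)))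
  · intro a j k hjk
    induction k with
    | zero => simp [Nat.le_zero.1 hjk]
    | succ k ih =>
      rcases Nat.le_succ_iff.1 hjk with h | rfl
      · exact (ih h).trans (Nat.le_add_right _ _)
      · exact Nat.le_add_left _ _

theorem le_encode_const (n : ℕ) : n ≤ encode (Code.const n) := by
  induction n with
  | zero => exact Nat.zero_le _
  | succ n ih => exact Nat.succ_le_of_lt (ih.trans_lt (Code.encode_lt_comp Code.succ _).2)

theorem le_encode_curry (c : Code) (n : ℕ) : n ≤ encode (Code.curry c n) :=
  (le_encode_const n).trans
    ((Code.encode_lt_pair _ _).1.trans (Code.encode_lt_comp c _).2).le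

theorem primrec_encode_curry (c : Code) : Primrec fun n => encode (Code.curry c n) :=
  Primrec.encode.comp (Code.primrec₂_curry.comp (Primrec.const c) Primrec.id)

theorem phi_encode (c : Code) : phi (encode c) = c.eval := by
  simp [phi]

theorem phi_zero_dom (x : ℕ) : (phi 0 x).Dom := by
  have h : (0 : ℕ) = encode Code.zero := rfl
  rw [h, phi_encode]
  trivial

end CodeSearch

section BoundedJump

open Nat.Partrec Encodable

theorem initSeg_getD {A : Set ℕ} {n i : ℕ} (h : i < n) : (initSeg A n).getD i 0 = chi A i := by
  simp [initSeg, h]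

theorem initSeg_getD_eq_one {A : Set ℕ} {n i : ℕ} (h : (initSeg A n).getD i 0 = 1) :
    i < n ∧ i ∈ A := by
  have hi : i < n := by
    by_contra hi
    rw [List.getD_eq_default _ _ (by simpa [initSeg] using hi)] at h
    exact zero_ne_one h
  rw [initSeg_getD hi] at h
  exact ⟨hi, by simpa [chi] using h⟩

theorem restrictTo_empty (n : ℕ) : restrictTo ∅ n = ∅ := by
  simp [restrictTo]

theorem mem_bJump_empty {x : ℕ} :
    x ∈ bJump ∅ ↔ ∃ n, (phi x (Nat.pair (encode (initSeg ∅ n)) x)).Dom := by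
  constructor
  · rintro ⟨i, -, h, hx⟩
    rw [restrictTo_empty] at hx
    exact hx
  · intro hx
    refine ⟨0, x.zero_le, phi_zero_dom x, ?_⟩
    rw [restrictTo_empty]
    exact hx

theorem encode_const_mem_bJump_empty (n : ℕ) : encode (Code.const n) ∈ bJump ∅ :=
  mem_bJump_empty.2 ⟨0, by rw [phi_encode, Code.eval_const]; trivial⟩

theorem exists_primrec_mem_bJump_empty_iff {α β : Type*} [Primcodable α] [Primcodable β]
    {R : α → β → Bool} (hR : Primrec₂ R) :
    ∃ h : α → ℕ, Primrec h ∧ ∀ a, h a ∈ bJump ∅ ↔ ∃ b, R a b := by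
  obtain ⟨c, hc, -⟩ := exists_code_search (α := α × ℕ) (P := fun a b => R a.1 b)
    (hR.comp (Primrec.fst.comp Primrec.fst) Primrec.snd) (g := fun _ _ => 0)
    (Primrec₂.const 0)
  refine ⟨fun a => encode (Code.curry c (encode a)),
    (primrec_encode_curry c).comp Primrec.encode, fun a => ?_⟩
  have key (y : ℕ) : ((Code.curry c (encode a)).eval y).Dom ↔ ∃ b, R a b := by
    rw [Code.eval_curry]
    exact hc (a, y)
  simp only [mem_bJump_empty, phi_encode, key, exists_const]

end BoundedJump

section OmegaSquare

open Nat.Partrec Encodable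

/-- The value at `ω · a + b` of the approximation for `n` computed by `c`, if it is found
within `k` steps. -/
def omegaSqStage (c : Code) (n a b k : ℕ) : Option ℕ :=
  Code.evaln k c (Nat.pair n (encode [a, b]))

theorem primrec_omegaSqStage (c : Code) :
    Primrec fun p : ℕ × ℕ × ℕ × ℕ => omegaSqStage c p.1 p.2.1 p.2.2.1 p.2.2.2 := by
  refine Code.primrec_evaln.comp (((Primrec.snd.comp (Primrec.snd.comp Primrec.snd)).pair
    (Primrec.const c)).pair (Primrec₂.natPair.comp Primrec.fst (Primrec.encode.comp ?_)))
  exact Primrec.list_cons.comp (Primrec.fst.comp Primrec.snd)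
    (Primrec.list_cons.comp (Primrec.fst.comp (Primrec.snd.comp Primrec.snd)) (Primrec.const []))

theorem primrec_omegaSqStage_comp (c : Code) {γ : Type*} [Primcodable γ] {n a b k : γ → ℕ}
    (hn : Primrec n) (ha : Primrec a) (hb : Primrec b) (hk : Primrec k) :
    Primrec fun x => omegaSqStage c (n x) (a x) (b x) (k x) :=
  (primrec_omegaSqStage c).comp (hn.pair (ha.pair (hb.pair hk)))

theorem exists_omegaSqStage {A : Set ℕ} (hA : OmegaCE 2 A) :
    ∃ c : Code, ∀ n, ∃ a b,
      (∀ a' b' k, (omegaSqStage c n a' b' k).isSome → a < a' ∨ a = a' ∧ b ≤ b') ∧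
      (∃ k, omegaSqStage c n a b k = some (chi A n)) ∧
      ∀ k y, omegaSqStage c n a b k = some y → y = chi A n := by
  obtain ⟨ψ, hψ, -, h⟩ := hA
  obtain ⟨c, rfl⟩ := Code.exists_code.1 (Partrec.nat_iff.1 hψ)
  refine ⟨c, fun n => ?_⟩
  obtain ⟨l, hl, hmin, hval⟩ := h n
  obtain ⟨a, b, rfl⟩ := List.length_eq_two.1 hl
  refine ⟨a, b, fun a' b' k hk => ?_, Code.evaln_complete.1 hval,
    fun k y hy => Part.mem_unique (Code.evaln_sound hy) hval⟩
  obtain ⟨y, hy⟩ := Option.isSome_iff_exists.1 hk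
  have hdom := Part.dom_iff_mem.2 ⟨y, Code.evaln_sound hy⟩
  by_contra! hlt
  refine hmin [a', b'] rfl ?_ hdom
  rcases hlt.1.lt_or_eq with h | rfl
  · exact .rel h
  · exact .cons (.rel (hlt.2 rfl))

end OmegaSquare

open Nat.Partrec Encodable in
/-- If `A` is `ω²`-c.e. then `A ≤₁ ∅^{2b}`. -/
theorem oneReducible_bIter_two_of_omegaSqCE (A : Set ℕ) (hA : OmegaCE 2 A) :
    oneReducible A (bIter 2) := by
  obtain ⟨c, hc⟩ := exists_omegaSqStage hA
  -- `h (n, a, b)` asks the bounded jump of `∅` whether the approximation for `n` converges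
  -- at some ordinal below `ω · a + b`.
  obtain ⟨h, h_primrec, h_mem⟩ := exists_primrec_mem_bJump_empty_iff
    (α := ℕ × ℕ × ℕ) (β := ℕ × ℕ × ℕ)
    (R := fun q t => (omegaSqStage c q.1 t.1 t.2.1 t.2.2).isSome &&
      (decide (t.1 < q.2.1) || (t.1 == q.2.1 && decide (t.2.1 < q.2.2)))) (by
    have ha : Primrec fun p : (ℕ × ℕ × ℕ) × ℕ × ℕ × ℕ => p.1.2.1 := by
      exact Primrec.fst.comp (Primrec.snd.comp Primrec.fst)
    have ha' : Primrec fun p : (ℕ × ℕ × ℕ) × ℕ × ℕ × ℕ => p.2.1 := by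
      exact Primrec.fst.comp Primrec.snd
    have hb : Primrec fun p : (ℕ × ℕ × ℕ) × ℕ × ℕ × ℕ => p.1.2.2 := by
      exact Primrec.snd.comp (Primrec.snd.comp Primrec.fst)
    have hb' : Primrec fun p : (ℕ × ℕ × ℕ) × ℕ × ℕ × ℕ => p.2.2.1 := by
      exact Primrec.fst.comp (Primrec.snd.comp Primrec.snd)
    exact Primrec.and.comp
      (Primrec.option_isSome.comp (primrec_omegaSqStage_comp c (Primrec.fst.comp Primrec.fst) ha'
        hb' (Primrec.snd.comp (Primrec.snd.comp Primrec.snd))))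
      (Primrec.or.comp (Primrec.nat_lt.decide.comp ha' ha)
        (Primrec.and.comp (Primrec.beq.comp ha' ha) (Primrec.nat_lt.decide.comp hb' hb))))
  have h_mem' (n a b : ℕ) : h (n, a, b) ∈ bJump ∅ ↔ ∃ a' b' k,
      (omegaSqStage c n a' b' k).isSome ∧ (a' < a ∨ a' = a ∧ b' < b) := by
    simp [h_mem]
  -- `p (n, a, b)` is an element of the bounded jump of `∅` that is at least `h (n, a, b)`; an
  -- oracle truncated too early to answer `h (n, a, b)` is recognised by not containing it.
  let p : ℕ × ℕ × ℕ → ℕ := fun q => encode (Code.const (h q))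
  have p_primrec : Primrec p := Primrec.encode.comp (Code.primrec_const.comp h_primrec)
  have p_mem (q) : p q ∈ bJump ∅ := encode_const_mem_bJump_empty _
  have h_le_p (q) : h q ≤ p q := le_encode_const _
  obtain ⟨d, hd, -⟩ := exists_code_search (α := (ℕ × ℕ) × List ℕ × ℕ) (β := ℕ × ℕ × ℕ)
    (P := fun q t => decide (omegaSqStage c q.1.1 t.1 t.2.1 t.2.2 = some 1) &&
      (q.2.1.getD (h (q.1.1, t.1, t.2.1)) 0 == 0 && q.2.1.getD (p (q.1.1, t.1, t.2.1)) 0 == 1))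
    (by
      have hn : Primrec fun x : ((ℕ × ℕ) × List ℕ × ℕ) × ℕ × ℕ × ℕ => x.1.1.1 := by
        exact Primrec.fst.comp (Primrec.fst.comp Primrec.fst)
      have ha : Primrec fun x : ((ℕ × ℕ) × List ℕ × ℕ) × ℕ × ℕ × ℕ => x.2.1 := by
        exact Primrec.fst.comp Primrec.snd
      have hb : Primrec fun x : ((ℕ × ℕ) × List ℕ × ℕ) × ℕ × ℕ × ℕ => x.2.2.1 := by
        exact Primrec.fst.comp (Primrec.snd.comp Primrec.snd)
      have hl : Primrec fun x : ((ℕ × ℕ) × List ℕ × ℕ) × ℕ × ℕ × ℕ => x.1.2.1 := by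
        exact Primrec.fst.comp (Primrec.snd.comp Primrec.fst)
      have hq := hn.pair (ha.pair hb)
      exact Primrec.and.comp
        (Primrec.eq.decide.comp (primrec_omegaSqStage_comp c hn ha hb
          (Primrec.snd.comp (Primrec.snd.comp Primrec.snd))) (Primrec.const (some 1)))
        (Primrec.and.comp
          (Primrec.beq.comp ((Primrec.list_getD 0).comp hl (h_primrec.comp hq)) (Primrec.const 0))
          (Primrec.beq.comp ((Primrec.list_getD 0).comp hl (p_primrec.comp hq))
            (Primrec.const 1))))
    (g := fun _ _ => 0) (Primrec₂.const 0)
  obtain ⟨G, G_primrec, hG⟩ := exists_primrec_bound (α := ℕ × ℕ)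
    (g := fun q b => p (q.1, q.2, b))
    (p_primrec.comp ((Primrec.fst.comp Primrec.fst).pair
      ((Primrec.snd.comp Primrec.fst).pair Primrec.snd)))
  obtain ⟨e, he_dom, he_mem⟩ := exists_code_search (α := (ℕ × ℕ) × ℕ) (β := ℕ × ℕ)
    (P := fun q t => (omegaSqStage c q.1.1 q.1.2 t.1 t.2).isSome)
    (Primrec.option_isSome.comp (primrec_omegaSqStage_comp c
      (Primrec.fst.comp (Primrec.fst.comp Primrec.fst))
      (Primrec.snd.comp (Primrec.fst.comp Primrec.fst))
      (Primrec.fst.comp Primrec.snd) (Primrec.snd.comp Primrec.snd)))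
    (g := fun q t => G q.1 t.1)
    (G_primrec.comp (Primrec.fst.comp Primrec.fst) (Primrec.fst.comp Primrec.snd))
  obtain ⟨I, I_primrec, hI⟩ := exists_primrec_bound (α := ℕ)
    (g := fun n a => encode (Code.curry e (Nat.pair n a)))
    ((primrec_encode_curry e).comp Primrec₂.natPair)
  obtain ⟨s, s_computable, hs⟩ := exists_computable_search (α := ℕ) (β := ℕ × ℕ × ℕ)
    (P := fun n t => (omegaSqStage c n t.1 t.2.1 t.2.2).isSome)
    (Primrec.option_isSome.comp (primrec_omegaSqStage_comp c Primrec.fst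
      (Primrec.fst.comp Primrec.snd) (Primrec.fst.comp (Primrec.snd.comp Primrec.snd))
      (Primrec.snd.comp (Primrec.snd.comp Primrec.snd))))
    (fun n => by
      obtain ⟨a, b, -, ⟨k, hk⟩, -⟩ := hc n
      exact ⟨(a, b, k), by simp [hk]⟩)
  let f : ℕ → ℕ := fun n => encode (Code.curry d (Nat.pair n (I n (s n).1)))
  have phi_f (n : ℕ) (l : List ℕ) : (phi (f n) (Nat.pair (encode l) (f n))).Dom ↔ ∃ a b k,
      omegaSqStage c n a b k = some 1 ∧ l.getD (h (n, a, b)) 0 = 0 ∧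
        l.getD (p (n, a, b)) 0 = 1 := by
    have := hd ((n, I n (s n).1), l, f n)
    simp only [Prod.exists, Bool.and_eq_true, beq_iff_eq, decide_eq_true_eq] at this
    rw [← this, phi_encode, Code.eval_curry]
    rfl
  refine ⟨f, (primrec_encode_curry d).to_comp.comp (Primrec₂.natPair.to_comp.comp Computable.id
    (I_primrec.to_comp.comp Computable.id (Computable.fst.comp s_computable))), ?_, fun n => ?_⟩
  · intro n m hnm
    exact (Nat.pair_eq_pair.1 (Code.curry_inj (encode_injective hnm)).2).1
  obtain ⟨a, b, hmin, ⟨k, hk⟩, hval⟩ := hc n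
  constructor
  · intro hn
    have ha : a ≤ (s n).1 := by
      rcases hmin _ _ _ (hs n) with h | h
      exacts [h.le, h.1.le]
    have hdom : (phi (encode (Code.curry e (Nat.pair n a))) (f n)).Dom := by
      rw [phi_encode, Code.eval_curry]
      exact (he_dom ((n, a), f n)).2 ⟨(b, k), by simp [hk]⟩
    refine ⟨_, (hI n a _ ha).trans ((Nat.right_le_pair _ _).trans (le_encode_curry _ _)), hdom, ?_⟩
    have hbound : p (n, a, b) ≤ (phi _ _).get hdom := by
      have hy := Part.get_mem hdom
      generalize (phi _ _).get hdom = y at hy ⊢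
      rw [phi_encode, Code.eval_curry] at hy
      obtain ⟨⟨b', k'⟩, hb', rfl⟩ := he_mem ((n, a), f n) y hy
      refine hG (n, a) b b' ?_
      rcases hmin _ _ _ hb' with h | h
      exacts [absurd h (lt_irrefl _), h.2]
    refine ⟨p (n, a, b) + 1, (phi_f _ _).2 ⟨a, b, k, by simpa [chi, hn] using hk, ?_, ?_⟩⟩
    · rw [initSeg_getD (Nat.lt_succ_of_le (h_le_p _))]
      have : h (n, a, b) ∉ bJump ∅ := by
        rw [h_mem']
        rintro ⟨a', b', k', h1, h2⟩
        have := hmin _ _ _ h1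
        omega
      exact if_neg fun hx => this hx.1
    · rw [initSeg_getD (Nat.lt_succ_self _)]
      exact if_pos ⟨p_mem _, hbound⟩
  · rintro ⟨i, -, hi, len, hlen⟩
    obtain ⟨a', b', k', h1, h2, h3⟩ := (phi_f _ _).1 hlen
    obtain ⟨hp, hp'⟩ := initSeg_getD_eq_one h3
    rw [initSeg_getD ((h_le_p _).trans_lt hp)] at h2
    have hnot : h (n, a', b') ∉ bJump ∅ := fun hx => by
      rw [chi, if_pos ⟨hx, (h_le_p _).trans hp'.2⟩] at h2
      exact one_ne_zero h2
    rw [h_mem'] at hnot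
    have hle := hmin a' b' k' (by simp [h1])
    have hge : ¬ (a < a' ∨ a = a' ∧ b < b') := fun hlt => hnot ⟨a, b, k, by simp [hk], hlt⟩
    obtain ⟨rfl, rfl⟩ : a = a' ∧ b = b' := by omega
    have := hval _ _ h1
    by_contra hn
    simp [chi, hn] at this
end

section
/- Let k > 1 and let A ⊆ ℕ be ω^k-c.e. Then A ≤₁ ∅^{kb}, the k-th iterate of the bounded jump of the empty set. -/
open Classical

namespace BoundedJump

open Nat.Partrec (Code)

theorem exists_code₂ {f : ℕ → ℕ →. ℕ} (hf : Partrec₂ f) :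
    ∃ c : Code, ∀ n b, c.eval (Nat.pair n b) = f n b := by
  have h : Partrec fun m : ℕ => f m.unpair.1 m.unpair.2 :=
    hf.comp (Computable.fst.comp Computable.unpair) (Computable.snd.comp Computable.unpair)
  obtain ⟨c, hc⟩ := Code.exists_code.1 (Partrec.nat_iff.1 h)
  exact ⟨c, fun n b => by rw [hc]; simp⟩

theorem le_encode_const (n : ℕ) : n ≤ Encodable.encode (Code.const n) := by
  induction n with
  | zero => exact Nat.zero_le _
  | succ n ih => exact Nat.succ_le_of_lt (ih.trans_lt (Code.encode_lt_comp _ _).2)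

theorem le_encode_curry (c : Code) (n : ℕ) : n ≤ Encodable.encode (Code.curry c n) :=
  (le_encode_const n).trans
    ((Code.encode_lt_pair _ Code.id).1.trans (Code.encode_lt_comp c _).2).le

theorem phi_encode (c : Code) : phi (Encodable.encode c) = c.eval := by
  simp [phi]

/-- Unbounded search for an argument at which a binary partial computable function converges. -/
theorem exists_search {f : ℕ → ℕ →. ℕ} (hf : Partrec₂ f) :
    ∃ s : ℕ →. ℕ, Partrec s ∧ (∀ n, (s n).Dom ↔ ∃ b, (f n b).Dom) ∧
      ∀ n, ∀ b ∈ s n, (f n b).Dom := by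
  obtain ⟨c, hc⟩ := exists_code₂ hf
  let t : ℕ → ℕ → Option ℕ := fun n k =>
    (Code.evaln k.unpair.1 c (Nat.pair n k.unpair.2)).map fun _ => k.unpair.2
  have ht : Computable₂ t := by
    have h1 : Primrec fun p : ℕ × ℕ =>
        Code.evaln p.2.unpair.1 c (Nat.pair p.1 p.2.unpair.2) :=
      Code.primrec_evaln.comp
        (((Primrec.fst.comp (Primrec.unpair.comp Primrec.snd)).pair (Primrec.const c)).pair
          (Primrec₂.natPair.comp Primrec.fst (Primrec.snd.comp (Primrec.unpair.comp Primrec.snd))))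
    exact (Primrec.option_map h1
      (Primrec.snd.comp (Primrec.unpair.comp (Primrec.snd.comp Primrec.fst))).to₂).to_comp
  have key : ∀ n b, (f n b).Dom ↔ ∃ k, b ∈ t n k := by
    intro n b
    rw [← hc, Part.dom_iff_mem]
    constructor
    · rintro ⟨y, hy⟩
      obtain ⟨k, hk⟩ := Code.evaln_complete.1 hy
      refine ⟨Nat.pair k b, ?_⟩
      simp only [Option.mem_def] at hk
      simp [t, hk]
    · rintro ⟨k, hk⟩
      simp only [t, Option.mem_def, Option.map_eq_some_iff] at hk
      obtain ⟨y, hy, rfl⟩ := hk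
      exact ⟨y, Code.evaln_sound hy⟩
  refine ⟨fun n => Nat.rfindOpt (t n), Partrec.rfindOpt ht, fun n => ?_, fun n b hb => ?_⟩
  · rw [Nat.rfindOpt_dom, exists_comm]
    exact exists_congr fun b => (key n b).symm
  · exact (key n b).2 (Nat.rfindOpt_spec hb)

/-- A computable binary function has a computable bound on initial segments of its
second argument. -/
theorem exists_bound {q : ℕ → ℕ → ℕ} (hq : Computable₂ q) :
    ∃ Q : ℕ → ℕ → ℕ, Computable₂ Q ∧ ∀ n a b, a ≤ b → q n a ≤ Q n b := by
  refine ⟨fun n b => Nat.rec (q n 0) (fun a ih => ih + q n (a + 1)) b, ?_, ?_⟩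
  · refine Computable.nat_rec (f := fun p : ℕ × ℕ => p.2) (g := fun p => q p.1 0)
      (h := fun p r => r.2 + q p.1 (r.1 + 1)) Computable.snd
      (hq.comp Computable.fst (Computable.const 0)) ?_
    refine Primrec.nat_add.to_comp.comp (Computable.snd.comp Computable.snd)
      (hq.comp (Computable.fst.comp Computable.fst)
        (Computable.succ.comp (Computable.fst.comp Computable.snd)))
  · intro n a b hab
    induction b with
    | zero =>
      obtain rfl : a = 0 := by omega
      exact le_rfl
    | succ b ih =>
      rcases Nat.lt_or_ge b a with h | h
      · obtain rfl : a = b + 1 := by omega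
        exact Nat.le_add_left _ _
      · exact (ih h).trans (Nat.le_add_right _ _)

/-- The `j`-th entry of the list of naturals coded by `s`. -/
def readBit (s j : ℕ) : ℕ := (((Encodable.decode s : Option (List ℕ)).getD [])[j]?).getD 0

theorem computable_readBit : Computable₂ readBit :=
  (Primrec.option_getD.comp
    (Primrec.list_getElem?.comp
      (Primrec.option_getD.comp (Primrec.decode.comp Primrec.fst) (Primrec.const []))
      Primrec.snd) (Primrec.const 0)).to_comp

theorem readBit_initSeg (B : Set ℕ) (l j : ℕ) :
    readBit (Encodable.encode (initSeg B l)) j = if j < l then chi B j else 0 := by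
  unfold readBit initSeg
  split_ifs with h
  · simp [h]
  · simp [h]

theorem readBit_of_marker {C : Set ℕ} {m l p : ℕ}
    (h : readBit (Encodable.encode (initSeg (restrictTo C m) l)) p = 1) {j : ℕ} (hj : j ≤ p) :
    readBit (Encodable.encode (initSeg (restrictTo C m) l)) j = chi C j := by
  rw [readBit_initSeg] at h ⊢
  have hl : p < l := by
    by_contra hl
    simp [hl] at h
  have hm : p ≤ m := by
    by_contra hm
    simp [hl, chi, restrictTo, hm] at h
  simp [hj.trans_lt hl, chi, restrictTo, hj.trans hm]

theorem chi_eq_one {C : Set ℕ} {j : ℕ} : chi C j = 1 ↔ j ∈ C := by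
  simp [chi]

theorem mem_bJump_encode {C : Set ℕ} {c : Code} :
    Encodable.encode c ∈ bJump C ↔ ∃ i ≤ Encodable.encode c, ∃ m ∈ phi i (Encodable.encode c),
      ∃ l, (c.eval (Nat.pair (Encodable.encode (initSeg (restrictTo C m) l))
        (Encodable.encode c))).Dom := by
  simp only [bJump, Set.mem_ofPred_eq, Phi, phi_encode]
  constructor
  · rintro ⟨i, hi, h, l, hl⟩
    exact ⟨i, hi, _, Part.get_mem h, l, hl⟩
  · rintro ⟨i, hi, m, ⟨h, rfl⟩, l, hl⟩
    exact ⟨i, hi, h, l, hl⟩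

/-- Every computably enumerable relation is many-one reducible to any bounded jump. -/
theorem exists_query {W : ℕ → ℕ →. ℕ} (hW : Partrec₂ W) :
    ∃ q : ℕ → ℕ → ℕ, Computable₂ q ∧ ∀ B n a, q n a ∈ bJump B ↔ (W n a).Dom := by
  have h2 : Partrec₂ fun m _ : ℕ => W m.unpair.1 m.unpair.2 :=
    hW.comp (Computable.fst.comp (Computable.unpair.comp Computable.fst))
      (Computable.snd.comp (Computable.unpair.comp Computable.fst))
  obtain ⟨c, hc⟩ := exists_code₂ h2
  refine ⟨fun n a => Encodable.encode (Code.curry c (Nat.pair n a)), ?_, fun B n a => ?_⟩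
  · exact (Primrec.encode.comp (Code.primrec₂_curry.comp (Primrec.const c)
      (Primrec₂.natPair.comp Primrec.fst Primrec.snd))).to_comp
  · rw [mem_bJump_encode]
    simp only [Code.eval_curry, hc, Nat.unpair_pair]
    constructor
    · rintro ⟨_, _, _, _, _, h⟩
      exact h
    · intro h
      refine ⟨0, Nat.zero_le _, 0, ?_, 0, h⟩
      have : phi 0 = Code.zero.eval := phi_encode Code.zero
      rw [this]
      exact Part.mem_some 0

/-- An element of every bounded jump that is at least `n`. -/
def marker (n : ℕ) : ℕ := Encodable.encode (Code.const n)

theorem le_marker (n : ℕ) : n ≤ marker n := le_encode_const n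

theorem computable_marker : Computable marker :=
  (Primrec.encode.comp Code.primrec_const).to_comp

theorem marker_mem (n : ℕ) (B : Set ℕ) : marker n ∈ bJump B := by
  refine mem_bJump_encode.2 ⟨0, Nat.zero_le _, 0, ?_, 0, by simp [Code.eval_const]⟩
  have : phi 0 = Code.zero.eval := phi_encode Code.zero
  rw [this]
  exact Part.mem_some 0

/-- Move the leading coefficient of an ordinal code from the second argument to the first. -/
def shift (f : ℕ → ℕ →. ℕ) : ℕ → ℕ →. ℕ :=
  fun p b => f p.unpair.1 (Nat.pair p.unpair.2 b + 1)

theorem shift_pair (f : ℕ → ℕ →. ℕ) (n a b : ℕ) :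
    shift f (Nat.pair n a) b = f n (Nat.pair a b + 1) := by
  simp [shift]

theorem partrec_shift {f : ℕ → ℕ →. ℕ} (hf : Partrec₂ f) : Partrec₂ (shift f) :=
  hf.comp (Computable.fst.comp (Computable.unpair.comp Computable.fst))
    (Computable.succ.comp (Primrec₂.natPair.to_comp.comp
      (Computable.snd.comp (Computable.unpair.comp Computable.fst)) Computable.snd))

/-- `f n` converges at the code of some ordinal below `ω^k`. -/
def Conv : ℕ → (ℕ → ℕ →. ℕ) → ℕ → Prop
  | 0, f, n => (f n 0).Dom
  | k + 1, f, n => ∃ a, Conv k (shift f) (Nat.pair n a)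

/-- `y` is the value of `f n` at the code of the least ordinal below `ω^k` where it converges. -/
def LeastVal : ℕ → (ℕ → ℕ →. ℕ) → ℕ → ℕ → Prop
  | 0, f, n, y => y ∈ f n 0
  | k + 1, f, n, y => ∃ a, (∀ a' < a, ¬ Conv k (shift f) (Nat.pair n a')) ∧
      LeastVal k (shift f) (Nat.pair n a) y

theorem LeastVal.conv {k : ℕ} {f : ℕ → ℕ →. ℕ} {n y : ℕ} (h : LeastVal k f n y) :
    Conv k f n := by
  induction k generalizing f n with
  | zero => exact Part.dom_iff_mem.2 ⟨y, h⟩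
  | succ k ih =>
    obtain ⟨a, -, ha⟩ := h
    exact ⟨a, ih ha⟩

theorem Conv.exists_list {k : ℕ} {f : ℕ → ℕ →. ℕ} {n : ℕ} (h : Conv k f n) :
    ∃ l : List ℕ, l.length = k ∧ (f n (Encodable.encode l)).Dom := by
  induction k generalizing f n with
  | zero => exact ⟨[], rfl, h⟩
  | succ k ih =>
    obtain ⟨a, ha⟩ := h
    obtain ⟨l, hl, hd⟩ := ih ha
    refine ⟨a :: l, by simp [hl], ?_⟩
    rw [shift_pair] at hd
    simpa using hd

theorem leastVal_of_list {k : ℕ} {f : ℕ → ℕ →. ℕ} {n y : ℕ} {l : List ℕ} (hl : l.length = k)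
    (hmin : ∀ l' : List ℕ, l'.length = k → List.Lex (· < ·) l' l →
      ¬ (f n (Encodable.encode l')).Dom)
    (hy : y ∈ f n (Encodable.encode l)) : LeastVal k f n y := by
  induction k generalizing f n l with
  | zero =>
    obtain rfl := List.length_eq_zero_iff.1 hl
    simpa using! hy
  | succ k ih =>
    obtain ⟨a, l, rfl⟩ := List.exists_cons_of_length_eq_add_one hl
    refine ⟨a, fun a' ha' hc => ?_, ih (l := l) (by simpa using hl) (fun l' hl' hlex => ?_) ?_⟩
    · obtain ⟨l', hl', hd⟩ := hc.exists_list
      refine hmin (a' :: l') (by simp [hl']) (List.Lex.rel ha') ?_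
      rw [shift_pair] at hd
      simpa using hd
    · rw [shift_pair]
      simpa using hmin (a :: l') (by simp [hl']) (List.Lex.cons hlex)
    · rw [shift_pair]
      simpa using hy

theorem exists_partrec_conv (k : ℕ) {f : ℕ → ℕ →. ℕ} (hf : Partrec₂ f) :
    ∃ s : ℕ →. ℕ, Partrec s ∧ ∀ n, (s n).Dom ↔ Conv k f n := by
  induction k generalizing f with
  | zero =>
    exact ⟨fun n => f n 0, hf.comp Computable.id (Computable.const 0), fun n => Iff.rfl⟩
  | succ k ih =>
    obtain ⟨s, hs, hd⟩ := ih (partrec_shift hf)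
    obtain ⟨t, ht, htd, -⟩ := exists_search (f := fun n a => s (Nat.pair n a))
      (hs.comp Primrec₂.natPair.to_comp)
    exact ⟨t, ht, fun n => (htd n).trans (exists_congr fun a => hd _)⟩

theorem exists_partrec_leading (k : ℕ) {f : ℕ → ℕ →. ℕ} (hf : Partrec₂ f) :
    ∃ s : ℕ →. ℕ, Partrec s ∧ (∀ n, Conv (k + 1) f n → (s n).Dom) ∧
      ∀ n, ∀ a ∈ s n, Conv k (shift f) (Nat.pair n a) := by
  obtain ⟨s, hs, hd⟩ := exists_partrec_conv k (partrec_shift hf)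
  obtain ⟨t, ht, htd, hts⟩ := exists_search (f := fun n a => s (Nat.pair n a))
    (hs.comp Primrec₂.natPair.to_comp)
  refine ⟨t, ht, fun n hn => (htd n).2 ?_, fun n a ha => (hd _).1 (hts n a ha)⟩
  obtain ⟨a, ha⟩ := hn
  exact ⟨a, (hd _).2 ha⟩

/-- Queries to a bounded jump deciding whether `f n` converges at an ordinal with
leading coefficient at most `a`. -/
theorem exists_leading_query (k : ℕ) {f : ℕ → ℕ →. ℕ} (hf : Partrec₂ f) :
    ∃ q : ℕ → ℕ → ℕ, Computable₂ q ∧ ∀ B n a,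
      q n a ∈ bJump B ↔ ∃ a' ≤ a, Conv k (shift f) (Nat.pair n a') := by
  obtain ⟨s, hs, hd⟩ := exists_partrec_conv k (partrec_shift hf)
  obtain ⟨t, ht, htd, -⟩ := exists_search
    (f := fun p a' => s (Nat.pair p.unpair.1 (min a' p.unpair.2)))
    (hs.comp (Primrec₂.natPair.to_comp.comp
      (Computable.fst.comp (Computable.unpair.comp Computable.fst))
      (Primrec.nat_min.to_comp.comp Computable.snd
        (Computable.snd.comp (Computable.unpair.comp Computable.fst)))))
  obtain ⟨q, hq, hqd⟩ := exists_query (W := fun n a => t (Nat.pair n a))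
    (ht.comp Primrec₂.natPair.to_comp)
  refine ⟨q, hq, fun B n a => ?_⟩
  rw [hqd, htd]
  simp only [Nat.unpair_pair, hd]
  constructor
  · rintro ⟨b, hb⟩
    exact ⟨_, min_le_right _ _, hb⟩
  · rintro ⟨b, hb, hc⟩
    exact ⟨b, by rwa [min_eq_left hb]⟩

/-- The least `a` such that the oracle `s` answers the query `q n a` positively. -/
def leastQuery (q : ℕ → ℕ → ℕ) (s n : ℕ) : Part ℕ :=
  Nat.rfind fun a => Part.some (readBit s (q n a) == 1)

theorem partrec_leastQuery {q : ℕ → ℕ → ℕ} (hq : Computable₂ q) : Partrec₂ (leastQuery q) := by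
  refine Partrec.rfind (p := fun (r : ℕ × ℕ) a => Part.some (readBit r.1 (q r.2 a) == 1)) ?_
  refine Computable.partrec (f := fun r : (ℕ × ℕ) × ℕ => readBit r.1.1 (q r.1.2 r.2) == 1) ?_
  exact Primrec.beq.to_comp.comp
    (computable_readBit.comp (Computable.fst.comp Computable.fst)
      (hq.comp (Computable.snd.comp Computable.fst) Computable.snd)) (Computable.const 1)

theorem mem_leastQuery {q : ℕ → ℕ → ℕ} {s n a : ℕ} :
    a ∈ leastQuery q s n ↔ readBit s (q n a) = 1 ∧ ∀ a' < a, readBit s (q n a') ≠ 1 := by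
  refine Nat.mem_rfind.trans ?_
  simp

theorem mem_leastQuery_iff {k : ℕ} {f : ℕ → ℕ →. ℕ} {q : ℕ → ℕ → ℕ} {C : Set ℕ} {s n a : ℕ}
    (hq : ∀ a, q n a ∈ C ↔ ∃ a' ≤ a, Conv k (shift f) (Nat.pair n a'))
    (hs : ∀ a' ≤ a, readBit s (q n a') = chi C (q n a')) :
    a ∈ leastQuery q s n ↔ Conv k (shift f) (Nat.pair n a) ∧
      ∀ a' < a, ¬ Conv k (shift f) (Nat.pair n a') := by
  have h1 : ∀ a' ≤ a, (readBit s (q n a') = 1 ↔ ∃ b ≤ a', Conv k (shift f) (Nat.pair n b)) :=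
    fun a' ha' => by rw [hs a' ha', chi_eq_one, hq]
  rw [mem_leastQuery, h1 a le_rfl]
  constructor
  · rintro ⟨⟨b, hb, hc⟩, hmin⟩
    have hmin' : ∀ a' < a, ¬ Conv k (shift f) (Nat.pair n a') := fun a' ha' hc' =>
      hmin a' ha' ((h1 a' ha'.le).2 ⟨a', le_rfl, hc'⟩)
    obtain rfl : b = a := by
      by_contra hne
      exact hmin' b (by omega) hc
    exact ⟨hc, hmin'⟩
  · rintro ⟨hc, hmin⟩
    refine ⟨⟨a, le_rfl, hc⟩, fun a' ha' h => ?_⟩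
    obtain ⟨b, hb, hcb⟩ := (h1 a' ha'.le).1 h
    exact hmin b (by omega) hcb

/-- The value of any partial computable function at the least ordinal below `ω^k` where it
converges can be computed from `C` with a partial computable bound on the use. -/
def ComputesLeastVal (k : ℕ) (C : Set ℕ) : Prop :=
  ∀ f : ℕ → ℕ →. ℕ, Partrec₂ f → ∃ (g : ℕ →. ℕ) (h : ℕ → ℕ →. ℕ), Partrec g ∧ Partrec₂ h ∧
    ∀ n y, y ≤ 1 → LeastVal k f n y →
      ∃ v ∈ g n, ∀ s, (∀ j ≤ v, readBit s j = chi C j) → y ∈ h s n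

/-- Partial computable injective reduction to `C` of the value at the least ordinal below `ω^k`. -/
def ReducesLeastVal (k : ℕ) (C : Set ℕ) : Prop :=
  ∀ f : ℕ → ℕ →. ℕ, Partrec₂ f → ∃ r : ℕ →. ℕ, Partrec r ∧
    (∀ n m x, x ∈ r n → x ∈ r m → n = m) ∧
    ∀ n y, y ≤ 1 → LeastVal k f n y → ∃ x ∈ r n, (x ∈ C ↔ y = 1)

theorem ReducesLeastVal.computes {k : ℕ} {C : Set ℕ} (h : ReducesLeastVal k C) :
    ComputesLeastVal k C := by
  intro f hf
  obtain ⟨r, hr, -, hv⟩ := h f hf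
  refine ⟨r, fun s n => (r n).map (readBit s), hr, ?_, fun n y hy1 hy => ?_⟩
  · exact (hr.comp Computable.snd).map
      (computable_readBit.comp (Computable.fst.comp Computable.fst) Computable.snd)
  · obtain ⟨x, hx, hxy⟩ := hv n y hy1 hy
    refine ⟨x, hx, fun s hs => Part.mem_map_iff _ |>.2 ⟨x, hx, ?_⟩⟩
    rw [hs x le_rfl, chi]
    split_ifs with hC
    · exact (hxy.1 hC).symm
    · have : y ≠ 1 := fun hy => hC (hxy.2 hy)
      omega

theorem computesLeastVal_one (B : Set ℕ) : ComputesLeastVal 1 (bJump B) := by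
  intro f hf
  obtain ⟨q, hq, hqd⟩ := exists_leading_query 0 hf
  obtain ⟨Q, hQ, hqQ⟩ := exists_bound hq
  obtain ⟨t, ht, htd, hts⟩ := exists_partrec_leading 0 hf
  refine ⟨fun n => (t n).map (Q n),
    fun s n => (leastQuery q s n).bind fun a => shift f (Nat.pair n a) 0, ht.map hQ, ?_, ?_⟩
  · refine Partrec.bind (f := fun p : ℕ × ℕ => leastQuery q p.1 p.2)
      (g := fun p a => shift f (Nat.pair p.2 a) 0) (partrec_leastQuery hq) ?_
    exact (partrec_shift hf).comp (Primrec₂.natPair.to_comp.comp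
      (Computable.snd.comp Computable.fst) Computable.snd) (Computable.const 0)
  · rintro n y - hy
    obtain ⟨a₀, ha₀⟩ := Part.dom_iff_mem.1 (htd n hy.conv)
    obtain ⟨a, hmin, ha⟩ := hy
    have hle : a ≤ a₀ := not_lt.1 fun hlt => hmin a₀ hlt (hts n a₀ ha₀)
    refine ⟨Q n a₀, Part.mem_map _ ha₀, fun s hs => Part.mem_bind_iff.2 ⟨a, ?_, ha⟩⟩
    exact (mem_leastQuery_iff (hqd B n) fun a' ha' => hs _ (hqQ n a' a₀ (ha'.trans hle))).2
      ⟨ha.conv, hmin⟩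

/-- Converges exactly at the argument `1`. -/
def guardOne (m : ℕ) : Part ℕ := Nat.rfind fun _ => Part.some (m == 1)

theorem partrec_guardOne : Partrec guardOne := by
  refine Partrec.rfind (p := fun (m : ℕ) (_ : ℕ) => Part.some (m == 1)) ?_
  exact Computable.partrec (f := fun r : ℕ × ℕ => r.1 == 1)
    (Primrec.beq.to_comp.comp Computable.fst (Computable.const 1))

theorem guardOne_dom {m : ℕ} : (guardOne m).Dom ↔ m = 1 := by
  rw [Part.dom_iff_mem]
  constructor
  · rintro ⟨x, hx⟩
    simpa using Nat.rfind_spec hx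
  · rintro rfl
    exact ⟨0, Nat.mem_rfind.2 (by simp)⟩

/-- Verification step: with oracle `s`, find the least leading coefficient, check that `s` is
reliable on the part it is used on, and check that the final value is `1`. -/
def verify (q Q : ℕ → ℕ → ℕ) (g : ℕ →. ℕ) (h : ℕ → ℕ →. ℕ) (s n : ℕ) : Part ℕ :=
  (leastQuery q s n).bind fun a => (g (Nat.pair n a)).bind fun v =>
    (guardOne (readBit s (marker (Q n a + v)))).bind fun _ =>
      (h s (Nat.pair n a)).bind guardOne

theorem partrec_verify {q Q : ℕ → ℕ → ℕ} {g : ℕ →. ℕ} {h : ℕ → ℕ →. ℕ} (hq : Computable₂ q)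
    (hQ : Computable₂ Q) (hg : Partrec g) (hh : Partrec₂ h) : Partrec₂ (verify q Q g h) := by
  refine Partrec.bind (f := fun p : ℕ × ℕ => leastQuery q p.1 p.2)
    (g := fun p a => (g (Nat.pair p.2 a)).bind fun v =>
      (guardOne (readBit p.1 (marker (Q p.2 a + v)))).bind fun _ =>
      (h p.1 (Nat.pair p.2 a)).bind guardOne) (partrec_leastQuery hq) ?_
  refine Partrec.bind (f := fun r : (ℕ × ℕ) × ℕ => g (Nat.pair r.1.2 r.2))
    (g := fun r v => (guardOne (readBit r.1.1 (marker (Q r.1.2 r.2 + v)))).bind fun _ =>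
      (h r.1.1 (Nat.pair r.1.2 r.2)).bind guardOne)
    (hg.comp (Primrec₂.natPair.to_comp.comp (Computable.snd.comp Computable.fst)
      Computable.snd)) ?_
  refine Partrec.bind
    (f := fun r : ((ℕ × ℕ) × ℕ) × ℕ => guardOne (readBit r.1.1.1 (marker (Q r.1.1.2 r.1.2 + r.2))))
    (g := fun r _ => (h r.1.1.1 (Nat.pair r.1.1.2 r.1.2)).bind guardOne) ?_ ?_
  · have hn : Computable fun r : ((ℕ × ℕ) × ℕ) × ℕ => r.1.1 := Computable.fst.comp Computable.fst
    exact partrec_guardOne.comp (computable_readBit.comp (Computable.fst.comp hn)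
      (computable_marker.comp (Primrec.nat_add.to_comp.comp
        (hQ.comp (Computable.snd.comp hn) (Computable.snd.comp Computable.fst)) Computable.snd)))
  · have hn : Computable fun r : (((ℕ × ℕ) × ℕ) × ℕ) × ℕ => r.1.1.1 :=
      Computable.fst.comp (Computable.fst.comp Computable.fst)
    refine Partrec.bind (f := fun r : (((ℕ × ℕ) × ℕ) × ℕ) × ℕ =>
      h r.1.1.1.1 (Nat.pair r.1.1.1.2 r.1.1.2)) (g := fun _ y => guardOne y) ?_ ?_
    · exact hh.comp (Computable.fst.comp hn) (Primrec₂.natPair.to_comp.comp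
        (Computable.snd.comp hn) (Computable.snd.comp (Computable.fst.comp Computable.fst)))
    · exact partrec_guardOne.comp Computable.snd

theorem verify_dom {q Q : ℕ → ℕ → ℕ} {g : ℕ →. ℕ} {h : ℕ → ℕ →. ℕ} {s n : ℕ} :
    (verify q Q g h s n).Dom ↔ ∃ a ∈ leastQuery q s n, ∃ v ∈ g (Nat.pair n a),
      readBit s (marker (Q n a + v)) = 1 ∧ 1 ∈ h s (Nat.pair n a) := by
  have hb : ∀ {p : Part ℕ} {r : ℕ → Part ℕ}, (p.bind r).Dom ↔ ∃ a ∈ p, (r a).Dom := by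
    intro p r
    constructor
    · rintro ⟨hp, hr⟩
      exact ⟨_, Part.get_mem hp, hr⟩
    · rintro ⟨a, ⟨hp, rfl⟩, hr⟩
      exact ⟨hp, hr⟩
  simp only [verify, hb, guardOne_dom]
  refine exists_congr fun a => and_congr_right fun _ => exists_congr fun v =>
    and_congr_right fun _ => ?_
  constructor
  · rintro ⟨z, hz, y, hy, rfl⟩
    exact ⟨guardOne_dom.1 (Part.dom_iff_mem.2 ⟨z, hz⟩), hy⟩
  · rintro ⟨h1, h2⟩
    obtain ⟨z, hz⟩ := Part.dom_iff_mem.1 (guardOne_dom.2 h1)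
    exact ⟨z, hz, 1, h2, rfl⟩

theorem ComputesLeastVal.reduces {k : ℕ} {B : Set ℕ} (hC : ComputesLeastVal k (bJump B)) :
    ReducesLeastVal (k + 1) (bJump (bJump B)) := by
  intro f hf
  obtain ⟨q, hq, hqd⟩ := exists_leading_query k hf
  obtain ⟨Q, hQ, hqQ⟩ := exists_bound hq
  obtain ⟨t, ht, htd, hts⟩ := exists_partrec_leading k hf
  obtain ⟨g, h, hg, hh, hgh⟩ := hC (shift f) (partrec_shift hf)
  -- codes for the bounds, one for each leading coefficient
  obtain ⟨cG, hcG⟩ := exists_code₂ (f := fun p _ =>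
      (g p).map fun v => marker (Q p.unpair.1 p.unpair.2 + v)) <| by
    refine (hg.comp Computable.fst).map (g := fun (r : ℕ × ℕ) v =>
      marker (Q r.1.unpair.1 r.1.unpair.2 + v)) ?_
    have hu : Computable fun r : (ℕ × ℕ) × ℕ => r.1.1.unpair :=
      Computable.unpair.comp (Computable.fst.comp Computable.fst)
    exact computable_marker.comp (Primrec.nat_add.to_comp.comp
      (hQ.comp (Computable.fst.comp hu) (Computable.snd.comp hu)) Computable.snd)
  obtain ⟨N, hN, hGN⟩ := exists_bound
    (q := fun n a => Encodable.encode (Code.curry cG (Nat.pair n a)))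
    ((Primrec.encode.comp (Code.primrec₂_curry.comp (Primrec.const cG)
      (Primrec₂.natPair.comp Primrec.fst Primrec.snd))).to_comp)
  obtain ⟨cM, hcM⟩ := exists_code₂ (f := fun p r => verify q Q g h r.unpair.1 p.unpair.1) <|
    (partrec_verify hq hQ hg hh).comp
      (Computable.fst.comp (Computable.unpair.comp Computable.snd))
      (Computable.fst.comp (Computable.unpair.comp Computable.fst))
  let x : ℕ → ℕ → ℕ := fun n a₀ => Encodable.encode (Code.curry cM (Nat.pair n (N n a₀)))
  have hx : Computable₂ x :=
    Computable.encode.comp (Code.primrec₂_curry.to_comp.comp (Computable.const cM)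
      (Primrec₂.natPair.to_comp.comp Computable.fst hN))
  refine ⟨fun n => (t n).map (x n), ht.map hx, ?_, ?_⟩
  · intro n m z hz hz'
    obtain ⟨a, -, rfl⟩ := (Part.mem_map_iff _).1 hz
    obtain ⟨b, -, hb⟩ := (Part.mem_map_iff _).1 hz'
    have := (Code.curry_inj (Encodable.encode_injective hb)).2
    exact (Nat.pair_eq_pair.1 this).1.symm
  intro n y hy1 hy
  obtain ⟨a₀, ha₀⟩ := Part.dom_iff_mem.1 (htd n hy.conv)
  refine ⟨x n a₀, Part.mem_map _ ha₀, ?_⟩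
  obtain ⟨a, hmin, ha⟩ := hy
  have hle : a ≤ a₀ := not_lt.1 fun hlt => hmin a₀ hlt (hts n a₀ ha₀)
  obtain ⟨v, hv, hval⟩ := hgh _ y hy1 ha
  refine mem_bJump_encode.trans ?_
  simp only [Code.eval_curry, hcM, Nat.unpair_pair, verify_dom]
  constructor
  · rintro ⟨_, -, m, -, l, a₁, ha₁, v₁, hv₁, hmark, hone⟩
    have hs := fun j (hj : j ≤ Q n a₁ + v₁) =>
      readBit_of_marker hmark (hj.trans (le_marker _))
    obtain ⟨hc₁, hmin₁⟩ := (mem_leastQuery_iff (hqd B n) fun a' ha' =>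
      hs _ ((hqQ n a' a₁ ha').trans (Nat.le_add_right _ _))).1 ha₁
    obtain rfl : a₁ = a := le_antisymm (not_lt.1 fun hlt => hmin₁ a hlt ha.conv)
      (not_lt.1 fun hlt => hmin a₁ hlt hc₁)
    obtain rfl := Part.mem_unique hv hv₁
    exact Part.mem_unique (hval _ fun j hj => hs j (hj.trans (Nat.le_add_left _ _))) hone
  · rintro rfl
    let p := marker (Q n a + v)
    have hs : ∀ j ≤ p, readBit (Encodable.encode (initSeg (restrictTo (bJump B) p) (p + 1))) j =
        chi (bJump B) j := by
      refine fun j hj => readBit_of_marker ?_ hj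
      rw [readBit_initSeg, if_pos (Nat.lt_succ_self p), chi_eq_one]
      exact ⟨marker_mem _ B, le_rfl⟩
    have hp : Q n a + v ≤ p := le_marker _
    refine ⟨Encodable.encode (Code.curry cG (Nat.pair n a)), ?_, p, ?_, p + 1, a, ?_, v, hv, ?_,
      hval _ fun j hj => hs j (by omega)⟩
    · exact (hGN n a a₀ hle).trans ((Nat.right_le_pair _ _).trans (le_encode_curry _ _))
    · rw [phi_encode, Code.eval_curry, hcG]
      exact (Part.mem_map_iff _).2 ⟨v, hv, by simp [p]⟩
    · exact (mem_leastQuery_iff (hqd B n) fun a' ha' =>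
        hs _ ((hqQ n a' a ha').trans (by omega))).2 ⟨ha.conv, hmin⟩
    · rw [hs p le_rfl, chi_eq_one]
      exact marker_mem _ B

theorem reducesLeastVal_bIter (k : ℕ) : ReducesLeastVal (k + 2) (bIter (k + 2)) := by
  induction k with
  | zero => exact (computesLeastVal_one ∅).reduces
  | succ k ih => exact ComputesLeastVal.reduces (B := bIter (k + 1)) ih.computes

end BoundedJump

/-- If `k > 1` and `A` is `ω^k`-c.e. then `A ≤₁ ∅^{kb}`. -/
theorem oneReducible_bIter_of_omegaCE (k : ℕ) (hk : 1 < k) (A : Set ℕ) (hA : OmegaCE k A) :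
    oneReducible A (bIter k) := by
  obtain ⟨k, rfl⟩ := Nat.exists_eq_add_of_le' hk
  obtain ⟨ψ, hψ, -, hval⟩ := hA
  obtain ⟨r, hr, hinj, hred⟩ := BoundedJump.reducesLeastVal_bIter k
    (fun n b => ψ (Nat.pair n b)) (hψ.comp Primrec₂.natPair.to_comp)
  have hx : ∀ n, ∃ x ∈ r n, (x ∈ bIter (k + 2) ↔ chi A n = 1) := fun n => by
    obtain ⟨l, hl, hmin, hmem⟩ := hval n
    exact hred n _ (by unfold chi; split_ifs <;> simp) (BoundedJump.leastVal_of_list hl hmin hmem)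
  choose f hf hfA using hx
  refine ⟨f, ?_, fun n m hnm => hinj n m (f n) (hf n) (hnm ▸ hf m), fun n => ?_⟩
  · exact hr.of_eq fun n => Part.eq_some_iff.2 (hf n)
  · rw [hfA, BoundedJump.chi_eq_one]
end
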